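/- Let l ≥ 1 and let σ_1, …, σ_l be types. Let P be the multivariate polynomial ring over k in variables indexed by the disjoint union (sigma type) of the σ_i, and for each i let I_i ⊆ P be the ideal generated by the variables of the i-th block. Then for every natural number j ≥ 0: (I_1 + I_2 + … + I_l)^{j+1} = ⋂ { I_1^{j_1+1} + I_2^{j_2+1} + … + I_l^{j_l+1} : (j_1, …, j_l) ∈ ℕ^l with j_1 + … + j_l = j }. -/

import Mathlib

open MvPolynomial

section MonomialIdeals

variable {R τ ι : Type*} [CommSemiring R]

theorem monomial_mem_span_X_image_pow_weight (S : Set τ) (m : τ →₀ ℕ) (c : R) :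
    monomial m c ∈ Ideal.span (X '' S : Set (MvPolynomial τ R)) ^
      Finsupp.weight (S.indicator (1 : τ → ℕ)) m := by
  suffices h : monomial m (1 : R) ∈ Ideal.span (X '' S : Set (MvPolynomial τ R)) ^
      Finsupp.weight (S.indicator (1 : τ → ℕ)) m by
    simpa [C_mul_monomial] using Ideal.mul_mem_left _ (C c) h
  induction m using Finsupp.induction_linear with
  | zero => simp
  | add a b ha hb =>
    rw [map_add, pow_add, ← one_mul (1 : R), ← monomial_mul]
    exact Ideal.mul_mem_mul ha hb
  | single s n =>
    rw [← X_pow_eq_monomial, Finsupp.weight_single]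
    by_cases hs : s ∈ S
    · simpa [hs] using Ideal.pow_mem_pow (Ideal.subset_span (Set.mem_image_of_mem X hs)) n
    · simp [hs]

theorem le_weight_of_mem_span_X_image_pow {S : Set τ} {n : ℕ} {p : MvPolynomial τ R}
    (hp : p ∈ Ideal.span (X '' S : Set (MvPolynomial τ R)) ^ n) {m : τ →₀ ℕ}
    (hm : m ∈ p.support) : n ≤ Finsupp.weight (S.indicator (1 : τ → ℕ)) m := by
  classical
  induction n generalizing p m with
  | zero => exact Nat.zero_le _
  | succ n ih =>
    rw [pow_succ] at hp
    induction hp using Submodule.mul_induction_on' with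
    | mem_mul_mem a ha b hb =>
      obtain ⟨u, hu, v, hv, rfl⟩ := Finset.mem_add.mp (support_mul a b hm)
      obtain ⟨s, hs, hvs⟩ := mem_ideal_span_X_image.mp hb v hv
      have hv1 : 1 ≤ Finsupp.weight (S.indicator (1 : τ → ℕ)) v := by
        simpa [hs] using
          Finsupp.le_weight_of_ne_zero' (S.indicator (1 : τ → ℕ)) hvs
      rw [map_add]
      exact add_le_add (ih ha hu) hv1
    | add a _ b _ iha ihb =>
      exact (Finset.mem_union.mp (support_add hm)).elim iha ihb

/-- A sum of powers of ideals generated by variables is the monomial ideal whose monomials have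
large enough degree in one of the sets of variables. -/
theorem mem_sum_span_X_image_pow_iff [Fintype ι] (S : ι → Set τ) (n : ι → ℕ)
    (p : MvPolynomial τ R) :
    p ∈ ∑ i, Ideal.span (X '' S i : Set (MvPolynomial τ R)) ^ n i ↔
      ∀ m ∈ p.support, ∃ i, n i ≤ Finsupp.weight ((S i).indicator (1 : τ → ℕ)) m := by
  classical
  rw [Ideal.sum_eq_sup, Finset.sup_univ_eq_iSup]
  constructor
  · intro hp
    induction hp using Submodule.iSup_induction' with
    | mem i a ha => exact fun m hm ↦ ⟨i, le_weight_of_mem_span_X_image_pow ha hm⟩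
    | zero => simp
    | add a b _ _ iha ihb =>
      exact fun m hm ↦ (Finset.mem_union.mp (support_add hm)).elim (iha m) (ihb m)
  · intro h
    rw [p.as_sum]
    refine Ideal.sum_mem _ fun m hm ↦ ?_
    obtain ⟨i, hi⟩ := h m hm
    exact Ideal.mem_iSup_of_mem i
      (Ideal.pow_le_pow_right hi (monomial_mem_span_X_image_pow_weight (S i) m _))

end MonomialIdeals

theorem sum_weight_indicator_fiber {τ ι : Type*} [Fintype ι] (g : τ → ι) (m : τ →₀ ℕ) :
    ∑ i, Finsupp.weight ((g ⁻¹' {i}).indicator (1 : τ → ℕ)) m = m.degree := by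
  classical
  simp only [Finsupp.weight_apply, Finsupp.sum, Finsupp.degree_apply]
  rw [Finset.sum_comm]
  simp [Set.indicator_apply]

theorem pow_sum_eq_iInf_blocks (k : Type*) [Field k] (l : ℕ) (hl : 1 ≤ l)
    (σ : Fin l → Type*)
    (I : Fin l → Ideal (MvPolynomial ((i : Fin l) × σ i) k))
    (hI : ∀ i : Fin l, I i = Ideal.span
      (Set.range fun s : σ i => (X ⟨i, s⟩ : MvPolynomial ((i : Fin l) × σ i) k)))
    (j : ℕ) :
    (∑ i : Fin l, I i) ^ (j + 1) =
      ⨅ (f : Fin l → ℕ) (_ : ∑ i : Fin l, f i = j), ∑ i : Fin l, (I i) ^ (f i + 1) := by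
  let B (i : Fin l) : Set ((i : Fin l) × σ i) := Sigma.fst ⁻¹' {i}
  have hB (i : Fin l) : I i = Ideal.span (X '' B i) := by
    rw [hI, show B i = Set.range (Sigma.mk i) from (Set.range_sigmaMk i).symm, ← Set.range_comp]
    rfl
  have hsum : ∑ i, I i = idealOfVars ((i : Fin l) × σ i) k := by
    simp_rw [Ideal.sum_eq_sup, Finset.sup_univ_eq_iSup, hB]
    rw [idealOfVars, ← Set.image_univ, ← Ideal.span_iUnion, ← Set.image_iUnion]
    congr 2
    ext s
    simp [B]
  ext p
  rw [hsum, mem_pow_idealOfVars_iff]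
  simp only [Submodule.mem_iInf, hB, mem_sum_span_X_image_pow_iff]
  constructor
  · rintro h f rfl m hm
    by_contra! hlt
    have hle := Finset.sum_le_sum fun i (_ : i ∈ Finset.univ) ↦ Nat.le_of_lt_succ (hlt i)
    rw [sum_weight_indicator_fiber] at hle
    exact absurd (h m hm) (by lia)
  · intro h m hm
    by_contra! hlt
    let d (i : Fin l) : ℕ := Finsupp.weight ((B i).indicator 1) m
    have hd : ∑ i, d i = m.degree := sum_weight_indicator_fiber _ m
    let f : Fin l → ℕ := d + Pi.single ⟨0, hl⟩ (j - m.degree)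
    have hf : ∑ i, f i = j := by
      simp only [f, Pi.add_apply, Finset.sum_add_distrib, hd, Finset.sum_pi_single',
        Finset.mem_univ, if_true]
      lia
    obtain ⟨i, hi⟩ := h f hf m hm
    have hdf : d i ≤ f i := Nat.le_add_right _ _
    exact absurd (hi.trans hdf) (by lia)
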